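/- arXiv:1504.07140 — 2 statements merged into one kernel-verified Lean document; each statement's English description precedes it below -/
import Mathlib

section
/- For every pair of integers n and k with 3 ≤ k ≤ n − 1, there exists a tournament T on n vertices such that the rainbow connection number of T equals k. -/
/-- A digraph is given by its arc relation `A`.  It is a tournament if it has no
loops and every two distinct vertices are joined by exactly one arc. -/
def IsTournament {V : Type*} (A : V → V → Prop) : Prop :=
  (∀ v : V, ¬ A v v) ∧ ∀ u v : V, u ≠ v → Xor' (A u v) (A v u)

/-- A (directed) path in the digraph `A`: a list of pairwise distinct vertices
in which every consecutive pair is an arc. -/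
def IsDipath {V : Type*} (A : V → V → Prop) (l : List V) : Prop :=
  l.Chain' A ∧ l.Nodup

/-- The arcs traversed by a path given as a list of vertices. -/
def pathArcs {V : Type*} (l : List V) : List (V × V) := l.zip l.tail

/-- A rainbow path for the arc-colouring `ρ`: a directed path no two of whose
arcs share the same colour. -/
def IsRainbowPath {V C : Type*} (A : V → V → Prop) (ρ : V → V → C) (l : List V) : Prop :=
  IsDipath A l ∧ ((pathArcs l).map (fun p => ρ p.1 p.2)).Nodup

/-- The digraph `A` is rainbow connected under the arc-colouring `ρ` if for every
ordered pair of vertices `u`, `v` there is a rainbow directed `uv`-path. -/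
def RainbowConnected {V C : Type*} (A : V → V → Prop) (ρ : V → V → C) : Prop :=
  ∀ u v : V, ∃ l : List V,
    l.head? = some u ∧ l.getLast? = some v ∧ IsRainbowPath A ρ l

/-- The rainbow connection number of the digraph `A`: the least number of colours
in an arc-colouring making `A` rainbow connected (`⊤` if there is none). -/
noncomputable def rc {V : Type*} (A : V → V → Prop) : ℕ∞ :=
  sInf {k : ℕ∞ | ∃ c : ℕ, k = (c : ℕ∞) ∧ ∃ ρ : V → V → Fin c, RainbowConnected A ρ}

/-- The level of a vertex: the first `m + 1` vertices lie on level `0`, each later vertex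
lies on its own level. -/
def level (m : ℕ) {n : ℕ} (x : Fin n) : ℕ := x.val - m

/-- Arcs go up by one level, down by at least two levels, and respect the natural order
within a level. -/
def LevelArc (m : ℕ) {n : ℕ} (u v : Fin n) : Prop :=
  level m v = level m u + 1 ∨ level m v + 2 ≤ level m u ∨ level m u = level m v ∧ u < v

/-- An ascending arc is coloured by the level of its tail, arcs from level `2` to level `0`
have colour `2`, and all other arcs have colour `0`. -/
def levelColour (m : ℕ) {n : ℕ} (u v : Fin n) : ℕ :=
  if level m v = level m u + 1 then level m u
  else if level m u = 2 ∧ level m v = 0 then 2 else 0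

theorem isTournament_levelArc (m n : ℕ) : IsTournament (LevelArc m (n := n)) := by
  constructor
  · intro v
    simp [LevelArc]
  · intro u v huv
    have h : u.val ≠ v.val := fun h => huv (Fin.ext h)
    change Xor _ _
    simp only [xor_def, LevelArc, level, Fin.lt_def]
    omega

section Paths

variable {V C : Type*}

theorem length_pathArcs (l : List V) : (pathArcs l).length = l.length - 1 := by
  simp [pathArcs]

theorem isRainbowPath_iff {A : V → V → Prop} {ρ : V → V → C} {l : List V} :
    IsRainbowPath A ρ l ↔
      (l.IsChain A ∧ l.Nodup) ∧ ((pathArcs l).map (fun p => ρ p.1 p.2)).Nodup :=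
  Iff.rfl

theorem isRainbowPath_singleton (A : V → V → Prop) (ρ : V → V → C) (u : V) :
    IsRainbowPath A ρ [u] := by
  simp [isRainbowPath_iff, pathArcs]

theorem isRainbowPath_cons_cons {A : V → V → Prop} {ρ : V → V → C} {u v : V} {l : List V} :
    IsRainbowPath A ρ (u :: v :: l) ↔
      A u v ∧ u ∉ v :: l ∧ ρ u v ∉ (pathArcs (v :: l)).map (fun p => ρ p.1 p.2) ∧
        IsRainbowPath A ρ (v :: l) := by
  have h : pathArcs (u :: v :: l) = (u, v) :: pathArcs (v :: l) := rfl
  simp only [isRainbowPath_iff, h, List.map_cons, List.nodup_cons (a := u),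
    List.nodup_cons (a := ρ u v), List.isChain_cons_cons]
  tauto

theorem IsRainbowPath.length_le {A : V → V → Prop} {c : ℕ} {ρ : V → V → Fin c} {l : List V}
    (h : IsRainbowPath A ρ l) : l.length - 1 ≤ c := by
  simpa [length_pathArcs] using h.2.length_le_card

theorem potential_getLast_le {A : V → V → Prop} {f : V → ℕ} (hf : ∀ u v, A u v → f v ≤ f u + 1)
    {u v : V} {l : List V} (hl : (u :: l).IsChain A) (hv : (u :: l).getLast? = some v) :
    f v ≤ f u + l.length := by
  induction l generalizing u with
  | nil => simp_all
  | cons w l ih =>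
    rw [List.isChain_cons_cons] at hl
    have := ih hl.2 (by simpa using hv)
    have := hf _ _ hl.1
    simp only [List.length_cons]
    omega

/-- A potential growing by at most one along arcs bounds the number of colours from below. -/
theorem le_of_rainbowConnected {A : V → V → Prop} {f : V → ℕ}
    (hf : ∀ u v, A u v → f v ≤ f u + 1) {c : ℕ} {ρ : V → V → Fin c}
    (h : RainbowConnected A ρ) (u v : V) : f v ≤ f u + c := by
  obtain ⟨l, hu, hv, hl⟩ := h u v
  obtain _ | ⟨w, l⟩ := l
  · simp at hu
  · obtain rfl : w = u := by simpa using hu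
    have h₁ := potential_getLast_le hf hl.1.1 hv
    have h₂ := hl.length_le
    simp only [List.length_cons] at h₂
    omega

end Paths

section Levels

variable {m n k : ℕ} {ρ : Fin n → Fin n → Fin k}

theorem exists_level_eq (hn : n = m + k + 1) {i : ℕ} (hi : i ≤ k) :
    ∃ x : Fin n, level m x = i :=
  ⟨⟨m + i, by omega⟩, by simp [level]⟩

theorem level_le (hn : n = m + k + 1) (x : Fin n) : level m x ≤ k := by
  have := x.isLt
  simp only [level]
  omega

theorem exists_ascending_rainbowPath (hn : n = m + k + 1)
    (hρ : ∀ u v, (ρ u v).val = levelColour m u v) (d : ℕ) (u v : Fin n)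
    (h : level m v = level m u + d + 1) :
    ∃ l, (u :: l).getLast? = some v ∧ IsRainbowPath (LevelArc m) ρ (u :: l) ∧
      (∀ x ∈ l, level m u < level m x) ∧
      ∀ p ∈ pathArcs (u :: l), level m u ≤ (ρ p.1 p.2).val := by
  induction d generalizing u with
  | zero =>
    refine ⟨[v], by simp, ?_, by simp [h], ?_⟩
    · rw [isRainbowPath_cons_cons]
      refine ⟨Or.inl h, ?_, by simp [pathArcs], isRainbowPath_singleton ..⟩
      rintro hu
      obtain rfl : u = v := by simpa using hu
      omega
    · simp [pathArcs, hρ, levelColour, h]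
  | succ d ih =>
    obtain ⟨w, hw⟩ := exists_level_eq (i := level m u + 1) hn
      (by have := level_le hn v; omega)
    obtain ⟨l, h₁, h₂, h₃, h₄⟩ := ih w (by omega)
    have hlev : ∀ x ∈ w :: l, level m u < level m x := by
      intro x hx
      rcases List.mem_cons.1 hx with rfl | hx
      · omega
      · have := h₃ x hx
        omega
    have hcol : (ρ u w).val = level m u := by simp [hρ, levelColour, hw]
    refine ⟨w :: l, by simpa using h₁, ?_, hlev, ?_⟩
    · refine isRainbowPath_cons_cons.2 ⟨Or.inl hw, fun hu => (hlev u hu).false, fun hu => ?_, h₂⟩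
      obtain ⟨p, hp, hpe⟩ := List.mem_map.1 hu
      have := h₄ p hp
      have := congrArg Fin.val hpe
      omega
    · intro p hp
      rcases List.mem_cons.1 (show p ∈ (u, w) :: pathArcs (w :: l) from hp) with rfl | hp
      · exact hcol.ge
      · have := h₄ p hp
        omega

theorem rainbowConnected_levelArc (hn : n = m + k + 1) (hk : 3 ≤ k)
    (hρ : ∀ u v, (ρ u v).val = levelColour m u v) :
    RainbowConnected (LevelArc m) ρ := by
  intro u v
  have two : ∀ w, LevelArc m u w → LevelArc m w v → u ≠ v →
      levelColour m u w ≠ levelColour m w v → ∃ l : List (Fin n),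
        l.head? = some u ∧ l.getLast? = some v ∧ IsRainbowPath (LevelArc m) ρ l := by
    intro w huw hwv huv hc
    have h₁ : u ≠ w := by rintro rfl; exact (isTournament_levelArc m n).1 _ huw
    have h₂ : w ≠ v := by rintro rfl; exact (isTournament_levelArc m n).1 _ hwv
    refine ⟨[u, w, v], by simp, by simp, ?_⟩
    simp only [isRainbowPath_cons_cons, isRainbowPath_singleton, pathArcs]
    simp [huw, hwv, h₁, h₂, huv, Fin.ext_iff, hρ, hc]
  have hu := level_le hn u
  have hv := level_le hn v
  by_cases huv : u = v
  · subst huv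
    exact ⟨[u], by simp, by simp, isRainbowPath_singleton ..⟩
  rcases lt_trichotomy (level m u) (level m v) with h | h | h
  · obtain ⟨l, h₁, h₂, -, -⟩ := exists_ascending_rainbowPath hn hρ
      (level m v - level m u - 1) u v (by omega)
    exact ⟨u :: l, by simp, h₁, h₂⟩
  · have hne : u.val ≠ v.val := fun h => huv (Fin.ext h)
    have hu0 : level m u = 0 := by simp only [level] at h ⊢; omega
    have hv0 : level m v = 0 := by omega
    obtain ⟨x, hx⟩ := exists_level_eq (i := 1) hn (by omega)
    obtain ⟨y, hy⟩ := exists_level_eq (i := 2) hn (by omega)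
    have ne : ∀ {a b : Fin n}, level m a ≠ level m b → a ≠ b := fun hab h => hab (h ▸ rfl)
    refine ⟨[u, x, y, v], by simp, by simp, ?_⟩
    simp only [isRainbowPath_cons_cons, isRainbowPath_singleton, pathArcs]
    simp [LevelArc, huv, Fin.ext_iff (n := k), hρ, levelColour, hu0, hv0, hx, hy,
      ne (a := u) (b := x) (by omega), ne (a := u) (b := y) (by omega),
      ne (a := x) (b := y) (by omega), ne (a := x) (b := v) (by omega),
      ne (a := y) (b := v) (by omega)]
  · by_cases h1 : level m v + 2 ≤ level m u
    · refine ⟨[u, v], by simp, by simp, ?_⟩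
      simp only [isRainbowPath_cons_cons, isRainbowPath_singleton, pathArcs]
      simp [LevelArc, huv, h1]
    by_cases h2 : level m u < k
    · obtain ⟨w, hw⟩ := exists_level_eq (i := level m u + 1) hn (by omega)
      refine two w (Or.inl hw) (Or.inr (Or.inl (by omega))) huv ?_
      simp only [levelColour]
      split_ifs <;> omega
    · obtain ⟨w, hw⟩ := exists_level_eq (i := k - 2) hn (by omega)
      refine two w (Or.inr (Or.inl (by omega))) (Or.inl (by omega)) huv ?_
      simp only [levelColour]
      split_ifs <;> omega

theorem levelColour_lt (hn : n = m + k + 1) (hk : 3 ≤ k) (u v : Fin n) :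
    levelColour m u v < k := by
  have := level_le hn v
  simp only [levelColour]
  split_ifs <;> omega

theorem rc_levelArc (hn : n = m + k + 1) (hk : 3 ≤ k) :
    rc (LevelArc m (n := n)) = (k : ℕ∞) := by
  apply le_antisymm
  · exact sInf_le ⟨k, rfl, fun u v => ⟨levelColour m u v, levelColour_lt hn hk u v⟩,
      rainbowConnected_levelArc hn hk fun _ _ => rfl⟩
  · refine le_sInf ?_
    rintro _ ⟨c, rfl, ρ, hρ⟩
    obtain ⟨u, hu⟩ := exists_level_eq (i := 0) hn (by omega)
    obtain ⟨v, hv⟩ := exists_level_eq (i := k) hn le_rfl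
    have := le_of_rainbowConnected (f := level m)
      (fun x y hxy => by unfold LevelArc at hxy; omega) hρ u v
    exact_mod_cast (by omega : k ≤ c)

end Levels

theorem exists_tournament_rc_eq' (n k : ℕ) (hk₁ : 3 ≤ k) (hk₂ : k ≤ n - 1) :
    ∃ A : Fin n → Fin n → Prop, IsTournament A ∧ rc A = (k : ℕ∞) :=
  ⟨LevelArc (n - 1 - k), isTournament_levelArc _ _, rc_levelArc (by omega) hk₁⟩
end

section
/- For every integer k ≥ 4, let T be the digraph on 2k vertices obtained from the circulant digraph C_{2k−1}(1, 2, 4, ..., 2(k−2)) with vertices u_0, ..., u_{2k−2} by adding a new vertex v with an arc (v, u_i) if i is even and an arc (u_i, v) if i is odd. Then T is a tournament on 2k vertices and its rainbow connection number equals 2. -/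
section RainbowPaths

variable {V C : Type*} {A : V → V → Prop} {ρ : V → V → C}

/-- Two consecutive arcs of different colours form a rainbow path. -/
lemma isRainbowPath_pair {x y z : V} (hxz : A x z) (hzy : A z y) (h₁ : x ≠ z) (h₂ : z ≠ y)
    (h₃ : x ≠ y) (hc : ρ x z ≠ ρ z y) : IsRainbowPath A ρ [x, z, y] := by
  refine ⟨⟨?_, ?_⟩, ?_⟩
  · change List.IsChain A _
    simp [hxz, hzy]
  · simp [h₁, h₂, h₃]
  · simpa [pathArcs] using hc

/-- In a tournament, rainbow paths of length at most two suffice for rainbow connection. -/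
lemma IsTournament.rainbowConnected (hA : IsTournament A)
    (h : ∀ x y, x ≠ y → A y x → ∃ z, A x z ∧ A z y ∧ ρ x z ≠ ρ z y) : RainbowConnected A ρ := by
  intro x y
  have hne : ∀ {u w}, A u w → u ≠ w := by
    rintro u w huw rfl
    exact hA.1 u huw
  by_cases hxy : x = y
  · subst hxy
    exact ⟨[x], rfl, rfl, ⟨List.isChain_singleton x, by simp⟩, by simp [pathArcs]⟩
  · rcases hA.2 x y hxy with ⟨hxy', -⟩ | ⟨hyx, -⟩
    · exact ⟨[x, y], rfl, rfl, ⟨List.isChain_pair.mpr hxy', by simp [hxy]⟩, by simp [pathArcs]⟩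
    · obtain ⟨z, hxz, hzy, hc⟩ := h x y hxy hyx
      exact ⟨[x, z, y], rfl, rfl, isRainbowPath_pair hxz hzy (hne hxz) (hne hzy) hxy hc⟩

/-- With at most one colour, rainbow connection forces an arc between any two vertices. -/
lemma RainbowConnected.arc_of_subsingleton [Subsingleton C] (h : RainbowConnected A ρ)
    {x y : V} (hxy : x ≠ y) : A x y := by
  obtain ⟨l, hx, hy, ⟨hl, -⟩, hc⟩ := h x y
  match l with
  | [] => simp at hx
  | [a] =>
    simp only [List.head?_cons, Option.some.injEq, List.getLast?_singleton] at hx hy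
    exact absurd (hx.symm.trans hy) hxy
  | [a, b] =>
    simp only [List.head?_cons, Option.some.injEq] at hx
    have hb : b = y := by simpa using hy
    subst hx hb
    exact List.isChain_pair.mp hl
  | a :: b :: c :: l =>
    simp only [pathArcs, List.tail_cons, List.zip_cons_cons, List.map_cons, List.nodup_cons,
      List.mem_cons, not_or] at hc
    exact absurd (Subsingleton.elim _ _) hc.1.1

/-- The rainbow connection number of a tournament with at least two vertices is at least two. -/
lemma IsTournament.two_le_rc [Nontrivial V] (hA : IsTournament A) : 2 ≤ rc A := by
  refine le_sInf ?_
  rintro _ ⟨c, rfl, σ, hσ⟩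
  by_contra hc
  have hc : c < 2 := by
    have := not_le.mp hc
    exact_mod_cast this
  have : Subsingleton (Fin c) := Fin.subsingleton_iff_le_one.mpr (by omega)
  obtain ⟨x, y, hxy⟩ := exists_pair_ne V
  have h₁ := hσ.arc_of_subsingleton hxy
  have h₂ := hσ.arc_of_subsingleton hxy.symm
  rcases hA.2 x y hxy with h | h
  · exact h.2 h₂
  · exact h.2 h₁

end RainbowPaths

/-- The digraph obtained from the circulant digraph `C_{2k-1}(1, 2, 4, ..., 2(k-2))` by adding
a vertex dominating the even vertices and dominated by the odd ones. -/
def circulantExtension (k : ℕ) (x y : Option (ZMod (2 * k - 1))) : Prop :=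
  match x, y with
  | none, none => False
  | none, some i => Even i.val
  | some i, none => Odd i.val
  | some i, some j =>
      ∃ s ∈ ({1} ∪ (Finset.Icc 1 (k - 2)).image (fun t => 2 * t) : Finset ℕ),
        j - i = (s : ZMod (2 * k - 1))

/-- The arcs between residues of the circulant digraph, in terms of representatives in
`{0, ..., 2k-2}`. -/
def ResidueArc (k x y : ℕ) : Prop :=
  y = x + 1 ∨ (x < y ∧ x % 2 = y % 2 ∧ ¬(x = 0 ∧ y = 2 * k - 2)) ∨
    (y + 3 ≤ x ∧ x % 2 ≠ y % 2) ∨ (x = 2 * k - 2 ∧ y = 0)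

section CirculantExtension

variable {k : ℕ}

lemma circulantExtension_some_some (hk : 4 ≤ k) (a b : ZMod (2 * k - 1)) :
    circulantExtension k (some a) (some b) ↔ ResidueArc k a.val b.val := by
  have : NeZero (2 * k - 1) := ⟨by omega⟩
  have ha := a.val_lt
  have hb := b.val_lt
  simp only [circulantExtension, ResidueArc, Finset.mem_union, Finset.mem_singleton,
    Finset.mem_image, Finset.mem_Icc]
  constructor
  · rintro ⟨s, hs, h⟩
    replace hs : s = 1 ∨ (s % 2 = 0 ∧ 2 ≤ s ∧ s ≤ 2 * k - 4) := by
      rcases hs with rfl | ⟨t, ht, rfl⟩ <;> omega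
    have hval : b.val = (a.val + s) % (2 * k - 1) := by
      have hba : b = ((a.val + s : ℕ) : ZMod (2 * k - 1)) := by
        rw [Nat.cast_add, ZMod.natCast_zmod_val, ← h]
        ring
      conv_lhs => rw [hba, ZMod.val_natCast]
    by_cases hlt : a.val + s < 2 * k - 1
    · rw [Nat.mod_eq_of_lt hlt] at hval
      omega
    · rw [Nat.mod_eq_sub_mod (by omega), Nat.mod_eq_of_lt (by omega)] at hval
      omega
  · intro h
    have key : ∀ s : ℕ, (a.val + s = b.val ∨ a.val + s = b.val + (2 * k - 1)) →
        b - a = (s : ZMod (2 * k - 1)) := by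
      intro s hs
      have hcast : ((a.val + s : ℕ) : ZMod (2 * k - 1)) = b := by
        rcases hs with hs | hs
        · rw [hs, ZMod.natCast_zmod_val]
        · rw [hs, Nat.cast_add, ZMod.natCast_self, add_zero, ZMod.natCast_zmod_val]
      rw [← hcast, Nat.cast_add, ZMod.natCast_zmod_val]
      ring
    rcases h with h | h | h | h
    · exact ⟨1, Or.inl rfl, key 1 (by omega)⟩
    · exact ⟨b.val - a.val, Or.inr ⟨(b.val - a.val) / 2, by omega, by omega⟩, key _ (by omega)⟩
    · exact ⟨2 * k - 1 + b.val - a.val,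
        Or.inr ⟨(2 * k - 1 + b.val - a.val) / 2, by omega, by omega⟩, key _ (by omega)⟩
    · exact ⟨1, Or.inl rfl, key 1 (by omega)⟩

lemma circulantExtension_none_some (b : ZMod (2 * k - 1)) :
    circulantExtension k none (some b) ↔ b.val % 2 = 0 := Nat.even_iff

lemma circulantExtension_some_none (a : ZMod (2 * k - 1)) :
    circulantExtension k (some a) none ↔ a.val % 2 = 1 := Nat.odd_iff

lemma isTournament_circulantExtension (hk : 4 ≤ k) : IsTournament (circulantExtension k) := by
  have : NeZero (2 * k - 1) := ⟨by omega⟩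
  constructor
  · rintro (_ | a)
    · exact id
    · rw [circulantExtension_some_some hk, ResidueArc]
      omega
  · rintro (_ | a) (_ | b) hab
    · exact absurd rfl hab
    · rw [circulantExtension_none_some, circulantExtension_some_none]
      refine xor_iff_iff_not.mpr ?_
      omega
    · rw [circulantExtension_none_some, circulantExtension_some_none]
      refine xor_iff_iff_not.mpr ?_
      omega
    · have hne : a.val ≠ b.val := fun h => hab (congrArg some (ZMod.val_injective _ h))
      have ha := a.val_lt
      have hb := b.val_lt
      rw [circulantExtension_some_some hk, circulantExtension_some_some hk]
      refine xor_iff_iff_not.mpr ?_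
      simp only [ResidueArc]
      omega

/-- The colour of an arc between residues, in terms of their representatives. -/
def residueColour (x y : ℕ) : Fin 2 :=
  if y = x + 1 ∨ x = 0 ∨ (x % 2 = 0 ∧ y % 2 = 1) then 0 else 1

/-- A two-colouring making `circulantExtension k` rainbow connected. -/
def extensionColouring (k : ℕ) : Option (ZMod (2 * k - 1)) → Option (ZMod (2 * k - 1)) → Fin 2
  | some a, some b => residueColour a.val b.val
  | none, some b => if b.val = 0 then 0 else 1
  | _, none => 1

lemma residueColour_ne_iff {x y x' y' : ℕ} : residueColour x y ≠ residueColour x' y' ↔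
    ((y = x + 1 ∨ x = 0 ∨ (x % 2 = 0 ∧ y % 2 = 1)) ↔
      ¬(y' = x' + 1 ∨ x' = 0 ∨ (x' % 2 = 0 ∧ y' % 2 = 1))) := by
  unfold residueColour
  split_ifs with h h' h' <;> simp [h, h']

lemma residueColour_ne_one_iff {x y : ℕ} : residueColour x y ≠ 1 ↔
    (y = x + 1 ∨ x = 0 ∨ (x % 2 = 0 ∧ y % 2 = 1)) := by
  unfold residueColour
  split_ifs with h <;> simp [h]

/-- If there is no arc between the representatives `x` and `y`, a third one joins them by two
arcs of different colours, unless `x = 1` and `y = 0`. -/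
lemma exists_residue_between (hk : 4 ≤ k) {x y : ℕ} (hx : x < 2 * k - 1) (hy : y < 2 * k - 1)
    (hyx : ResidueArc k y x) (h10 : ¬(x = 1 ∧ y = 0)) :
    ∃ z < 2 * k - 1, ResidueArc k x z ∧ ResidueArc k z y ∧
      residueColour x z ≠ residueColour z y := by
  simp only [residueColour_ne_iff]
  unfold ResidueArc at *
  rcases hyx with h | h | h | h
  · rcases Nat.mod_two_eq_zero_or_one x with hp | hp
    · by_cases h2 : x = 2
      · exact ⟨4, by omega, by omega, by omega, by omega⟩
      · exact ⟨1, by omega, by omega, by omega, by omega⟩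
    · exact ⟨0, by omega, by omega, by omega, by omega⟩
  · rcases Nat.mod_two_eq_zero_or_one x with hp | hp
    · by_cases h2 : x = 2 * k - 2
      · exact ⟨0, by omega, by omega, by omega, by omega⟩
      · exact ⟨x + 1, by omega, by omega, by omega, by omega⟩
    · exact ⟨y - 1, by omega, by omega, by omega, by omega⟩
  · exact ⟨x + 1, by omega, by omega, by omega, by omega⟩
  · exact ⟨2, by omega, by omega, by omega, by omega⟩

lemma rainbowConnected_circulantExtension (hk : 4 ≤ k) :
    RainbowConnected (circulantExtension k) (extensionColouring k) := by
  have : NeZero (2 * k - 1) := ⟨by omega⟩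
  have hval : ∀ z < 2 * k - 1, ((z : ZMod (2 * k - 1))).val = z := fun z hz =>
    ZMod.val_cast_of_lt hz
  refine (isTournament_circulantExtension hk).rainbowConnected ?_
  rintro (_ | a) (_ | b) hab hba
  · exact absurd rfl hab
  · rw [circulantExtension_some_none] at hba
    have hb := b.val_lt
    obtain ⟨z, hz, hz0, hz2, hzb, hc⟩ : ∃ z < 2 * k - 1, z ≠ 0 ∧ z % 2 = 0 ∧
        ResidueArc k z b.val ∧ residueColour z b.val ≠ 1 := by
      simp only [residueColour_ne_one_iff]
      unfold ResidueArc
      by_cases h1 : b.val = 1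
      · exact ⟨4, by omega, by omega, by omega, by omega, by omega⟩
      · exact ⟨b.val - 1, by omega, by omega, by omega, by omega, by omega⟩
    refine ⟨some (z : ZMod (2 * k - 1)), ?_, ?_, ?_⟩
    · rwa [circulantExtension_none_some, hval z hz]
    · rwa [circulantExtension_some_some hk, hval z hz]
    · simpa only [extensionColouring, hval z hz, if_neg hz0] using hc.symm
  · rw [circulantExtension_none_some] at hba
    have ha := a.val_lt
    obtain ⟨z, hz, hz2, haz, hc⟩ : ∃ z < 2 * k - 1, z % 2 = 1 ∧
        ResidueArc k a.val z ∧ residueColour a.val z ≠ 1 := by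
      simp only [residueColour_ne_one_iff]
      unfold ResidueArc
      by_cases h1 : a.val = 2 * k - 2
      · exact ⟨1, by omega, by omega, by omega, by omega⟩
      · exact ⟨a.val + 1, by omega, by omega, by omega, by omega⟩
    refine ⟨some (z : ZMod (2 * k - 1)), ?_, ?_, ?_⟩
    · rwa [circulantExtension_some_some hk, hval z hz]
    · rwa [circulantExtension_some_none, hval z hz]
    · simpa only [extensionColouring, hval z hz] using hc
  · rw [circulantExtension_some_some hk] at hba
    by_cases h10 : a.val = 1 ∧ b.val = 0
    · refine ⟨none, ?_, ?_, ?_⟩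
      · rw [circulantExtension_some_none, h10.1]
      · rw [circulantExtension_none_some, h10.2]
      · simp [extensionColouring, h10.2]
    · obtain ⟨z, hz, haz, hzb, hc⟩ := exists_residue_between hk a.val_lt b.val_lt hba h10
      refine ⟨some (z : ZMod (2 * k - 1)), ?_, ?_, ?_⟩
      · rwa [circulantExtension_some_some hk, hval z hz]
      · rwa [circulantExtension_some_some hk, hval z hz]
      · simpa only [extensionColouring, hval z hz] using hc

lemma rc_circulantExtension (hk : 4 ≤ k) : rc (circulantExtension k) = 2 :=
  le_antisymm
    (sInf_le ⟨2, rfl, extensionColouring k, rainbowConnected_circulantExtension hk⟩)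
    (isTournament_circulantExtension hk).two_le_rc

end CirculantExtension

theorem even_order_tournament_rc_two (k : ℕ) (hk : 4 ≤ k) :
    Nat.card (Option (ZMod (2 * k - 1))) = 2 * k ∧
    IsTournament (fun x y : Option (ZMod (2 * k - 1)) =>
      match x, y with
      | some i, some j =>
          ∃ s ∈ ({1} ∪ (Finset.Icc 1 (k - 2)).image (fun t => 2 * t) : Finset ℕ),
            j - i = (s : ZMod (2 * k - 1))
      | none, some i => Even i.val
      | some i, none => Odd i.val
      | none, none => False) ∧
    rc (fun x y : Option (ZMod (2 * k - 1)) =>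
      match x, y with
      | some i, some j =>
          ∃ s ∈ ({1} ∪ (Finset.Icc 1 (k - 2)).image (fun t => 2 * t) : Finset ℕ),
            j - i = (s : ZMod (2 * k - 1))
      | none, some i => Even i.val
      | some i, none => Odd i.val
      | none, none => False) = 2 := by
  have : NeZero (2 * k - 1) := ⟨by omega⟩
  have h : ∀ A, A = circulantExtension k → IsTournament A ∧ rc A = 2 := by
    rintro _ rfl
    exact ⟨isTournament_circulantExtension hk, rc_circulantExtension hk⟩
  refine ⟨?_, h _ ?_⟩
  · rw [Nat.card_eq_fintype_card, Fintype.card_option, ZMod.card]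
    omega
  · funext x y
    rcases x with _ | x <;> rcases y with _ | y <;> rfl
end
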